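/- Transparency of the bottom of the stack: let H₀, …, H_k be a valid stack sequence for adaptation functions f₀, …, f_{k−1}, let b be a natural number with |H_i| ≥ b + 1 for all 0 ≤ i ≤ k, and write H₀ = T₀ ++ B where B is the list of the bottom b symbols of H₀ (|B| = b). Then (i) for every 0 ≤ i ≤ k there is a list T_i with H_i = T_i ++ B (the bottom b symbols never change), and (ii) for every list B' over A with |B'| = b, the sequence T₀ ++ B', T₁ ++ B', …, T_k ++ B' is also a valid stack sequence for f₀, …, f_{k−1}. -/

import Mathlib

/-- An adaptation function over a protocol set `A`: a conversion `(a→b)`,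
an encapsulation `(a→ab)`, or a decapsulation `(a→ab)‾`. -/
inductive AdaptFun (A : Type) where
  | conv : A → A → AdaptFun A
  | encap : A → A → AdaptFun A
  | decap : A → A → AdaptFun A
deriving DecidableEq

/-- The partial action of an adaptation function on a protocol stack
(a list whose head is the top of the stack). -/
def AdaptFun.apply {A : Type} [DecidableEq A] : AdaptFun A → List A → Option (List A)
  | .conv a b, x :: T => if x = a then some (b :: T) else none
  | .encap a b, x :: T => if x = a then some (b :: a :: T) else none
  | .decap a b, y :: x :: T => if y = b ∧ x = a then some (a :: T) else none
  | _, _ => none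

/-- `H₀, …, H_ℓ` is a valid stack sequence for `f₀, …, f_{ℓ-1}`: for every `i < ℓ`,
the action of `f i` on `H i` is defined and equals `H (i+1)`. -/
def ValidSeq {A : Type} [DecidableEq A] (f : ℕ → AdaptFun A) (H : ℕ → List A) (ℓ : ℕ) : Prop :=
  ∀ i < ℓ, (f i).apply (H i) = some (H (i + 1))

/-- A step that is defined on `T ++ B` with `T` nonempty, and whose result is strictly longer
than `B`, acts on the top part only. -/
theorem AdaptFun.apply_append_eq_some {A : Type} [DecidableEq A] {g : AdaptFun A}
    {T B H : List A} (hT : T ≠ []) (hg : g.apply (T ++ B) = some H)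
    (hH : B.length < H.length) :
    ∃ T', H = T' ++ B ∧ ∀ B', g.apply (T ++ B') = some (T' ++ B') := by
  obtain ⟨x, T, rfl⟩ := List.exists_cons_of_ne_nil hT
  cases g with
  | conv a c =>
    simp only [List.cons_append, AdaptFun.apply, Option.ite_none_right_eq_some,
      Option.some.injEq] at hg
    obtain ⟨rfl, rfl⟩ := hg
    exact ⟨c :: T, rfl, fun B' => by simp [AdaptFun.apply]⟩
  | encap a c =>
    simp only [List.cons_append, AdaptFun.apply, Option.ite_none_right_eq_some,
      Option.some.injEq] at hg
    obtain ⟨rfl, rfl⟩ := hg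
    exact ⟨c :: x :: T, rfl, fun B' => by simp [AdaptFun.apply]⟩
  | decap a c =>
    cases T with
    | nil =>
      cases B with
      | nil => simp [AdaptFun.apply] at hg
      | cons y B =>
        simp only [List.cons_append, List.nil_append, AdaptFun.apply,
          Option.ite_none_right_eq_some, Option.some.injEq] at hg
        obtain ⟨-, rfl⟩ := hg
        simp at hH
    | cons y T =>
      simp only [List.cons_append, AdaptFun.apply, Option.ite_none_right_eq_some,
        Option.some.injEq] at hg
      obtain ⟨⟨rfl, rfl⟩, rfl⟩ := hg
      exact ⟨y :: T, rfl, fun B' => by simp [AdaptFun.apply]⟩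

/-- Transparency of the bottom of the stack: if along a valid stack sequence every stack
has height at least `b + 1`, then the bottom `b` symbols `B` never change, and replacing
`B` by any other list `B'` of length `b` again yields a valid stack sequence. -/
theorem validSeq_bottom_transparent {A : Type} [DecidableEq A]
    (f : ℕ → AdaptFun A) (H : ℕ → List A) (k : ℕ) (hv : ValidSeq f H k)
    (b : ℕ) (hb : ∀ i ≤ k, b + 1 ≤ (H i).length)
    (T₀ B : List A) (hB : B.length = b) (h0 : H 0 = T₀ ++ B) :
    ∃ T : ℕ → List A, T 0 = T₀ ∧ (∀ i ≤ k, H i = T i ++ B) ∧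
      ∀ B' : List A, B'.length = b → ValidSeq f (fun i => T i ++ B') k := by
  subst hB
  have take_eq {L T : List A} (h : L = T ++ B) : L.take (L.length - B.length) = T := by
    simp [h]
  have step (i : ℕ) (hi : i < k) (T : List A) (hT : H i = T ++ B) :
      ∃ T', H (i + 1) = T' ++ B ∧ ∀ B', (f i).apply (T ++ B') = some (T' ++ B') := by
    refine AdaptFun.apply_append_eq_some ?_ (hT ▸ hv i hi) (hb (i + 1) hi)
    rintro rfl
    have := hb i hi.le
    simp [hT] at this
  have bottom (i : ℕ) (hi : i ≤ k) : ∃ T, H i = T ++ B := by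
    induction i with
    | zero => exact ⟨T₀, h0⟩
    | succ i ih =>
      obtain ⟨T, hT⟩ := ih (by omega)
      obtain ⟨T', hT', -⟩ := step i hi T hT
      exact ⟨T', hT'⟩
  refine ⟨fun i => (H i).take ((H i).length - B.length), take_eq h0, fun i hi => ?_,
    fun B' _ i hi => ?_⟩
  · obtain ⟨T, hT⟩ := bottom i hi
    simpa only [take_eq hT] using hT
  · obtain ⟨T, hT⟩ := bottom i hi.le
    obtain ⟨T', hT', h⟩ := step i hi T hT
    simpa only [take_eq hT, take_eq hT'] using h B'
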